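/- Let n ≥ 3, m = C(n,2), and let d be a metric on V_n, regarded as the vector in ℝ^m whose {i,j}-coordinate is d(i,j). Define w ∈ ℝ^{2^n − 2} (coordinates indexed by nontrivial cuts) by w_C = (1/2^{n−2})·( s_C − (|C|·(n − |C|)/(m + 1))·Tr(d) ). Then S·w = d. -/

import Mathlib

open Finset Matrix

/-- The 2-element subsets of `V_n = Fin n`; there are `C(n,2)` of them. -/
abbrev Pairs (n : ℕ) := {P : Finset (Fin n) // P.card = 2}

/-- The nontrivial cuts of `V_n = Fin n`: subsets `C` with `∅ ⊊ C ⊊ V_n`;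
there are `2^n − 2` of them. -/
abbrev Cuts (n : ℕ) := {C : Finset (Fin n) // C ≠ ∅ ∧ C ≠ Finset.univ}

/-- The full cut-matrix `S`: rows indexed by the 2-element subsets `{i,j}` of `V_n`,
columns indexed by the nontrivial cuts `C`, with entry `δ_C(i,j)`, i.e. 1 iff
`|{i,j} ∩ C| = 1` (exactly one of `i, j` lies in `C`). -/
def fullCutMatrix (n : ℕ) : Matrix (Pairs n) (Cuts n) ℝ :=
  Matrix.of fun P C => if (P.1 ∩ C.1).card = 1 then 1 else 0

/-- A metric on a finite set. -/
def IsMetric {α : Type*} (d : α → α → ℝ) : Prop :=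
  (∀ i, d i i = 0) ∧ (∀ i j, d i j = d j i) ∧
  (∀ i j, i ≠ j → 0 < d i j) ∧ (∀ i j k, d i j ≤ d i k + d k j)

/-- The trace `Tr(d) = ∑_{i<j} d(i,j)`. -/
def traceMetric {n : ℕ} (d : Fin n → Fin n → ℝ) : ℝ :=
  ∑ i : Fin n, ∑ j ∈ Finset.univ.filter (fun j => i < j), d i j

/-- The `C`-trace `s_C = ∑_{i ∈ C, j ∉ C} d(i,j)`. -/
def cutTrace {n : ℕ} (d : Fin n → Fin n → ℝ) (C : Finset (Fin n)) : ℝ :=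
  ∑ i ∈ C, ∑ j ∈ Cᶜ, d i j

/-- For a symmetric function `d` vanishing on the diagonal, `pairEval d {i,j} = d i j`:
this realizes `d` as a vector in `ℝ^{C(n,2)}`. -/
noncomputable def pairEval {n : ℕ} (d : Fin n → Fin n → ℝ) (P : Finset (Fin n)) : ℝ :=
  (∑ i ∈ P, ∑ j ∈ P, d i j) / 2

/-- The indicator `δ_C(i,j)` of `C` separating `i` and `j`. -/
def cutInd {n : ℕ} (C : Finset (Fin n)) (i j : Fin n) : ℝ :=
  if (i ∈ C ↔ j ∈ C) then 0 else 1

lemma cutInd_comm {n : ℕ} (C : Finset (Fin n)) (i j : Fin n) :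
    cutInd C i j = cutInd C j i := by
  simp only [cutInd, iff_comm]

lemma cutInd_mul_self {n : ℕ} (C : Finset (Fin n)) (i j : Fin n) :
    cutInd C i j * cutInd C i j = cutInd C i j := by
  unfold cutInd
  split_ifs <;> simp

lemma cutInd_symmDiff_singleton_left {n : ℕ} (C : Finset (Fin n)) {i j : Fin n} (h : i ≠ j) :
    cutInd (symmDiff C {i}) i j = 1 - cutInd C i j := by
  by_cases hi : i ∈ C <;> by_cases hj : j ∈ C <;>
    simp [cutInd, mem_symmDiff, hi, hj, h.symm]

lemma cutInd_symmDiff_singleton_of_ne {n : ℕ} (C : Finset (Fin n)) {i a b : Fin n}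
    (ha : a ≠ i) (hb : b ≠ i) : cutInd (symmDiff C {i}) a b = cutInd C a b := by
  simp [cutInd, mem_symmDiff, ha, hb]

lemma sum_symmDiff_singleton {n : ℕ} (f : Finset (Fin n) → ℝ) (i : Fin n) :
    ∑ C, f (symmDiff C {i}) = ∑ C, f C :=
  Equiv.sum_comp (symmDiff_left_involutive ({i} : Finset (Fin n))).toPerm f

lemma two_mul_sum_cutInd {n : ℕ} {a b : Fin n} (h : a ≠ b) :
    2 * ∑ C : Finset (Fin n), cutInd C a b = 2 ^ n := by
  have key := sum_symmDiff_singleton (fun C => cutInd C a b) a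
  simp only [cutInd_symmDiff_singleton_left _ h, sum_sub_distrib] at key
  simp at key
  linarith

lemma two_mul_sum_cutInd_mul_of_notMem {n : ℕ} {a b i j : Fin n} (hij : i ≠ j)
    (ha : a ≠ i) (hb : b ≠ i) :
    2 * ∑ C : Finset (Fin n), cutInd C a b * cutInd C i j =
      ∑ C : Finset (Fin n), cutInd C a b := by
  have key := sum_symmDiff_singleton (fun C => cutInd C a b * cutInd C i j) i
  simp only [cutInd_symmDiff_singleton_left _ hij, cutInd_symmDiff_singleton_of_ne _ ha hb,
    mul_sub, mul_one, sum_sub_distrib] at key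
  linarith

/-- Two distinct pairs are both separated by a quarter of all subsets, and a single pair by half
of them. -/
lemma four_mul_sum_cutInd_mul {n : ℕ} {a b i j : Fin n} (hab : a ≠ b) (hij : i ≠ j) :
    4 * ∑ C : Finset (Fin n), cutInd C a b * cutInd C i j =
      2 ^ n * (1 + (if i = a ∧ j = b then 1 else 0) + (if i = b ∧ j = a then 1 else 0)) := by
  have h2 := two_mul_sum_cutInd hab
  by_cases h₁ : i = a ∧ j = b
  · obtain ⟨rfl, rfl⟩ := h₁
    simp only [cutInd_mul_self, hij, and_self, if_true, false_and, if_false]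
    linarith
  by_cases h₂ : i = b ∧ j = a
  · obtain ⟨rfl, rfl⟩ := h₂
    simp only [cutInd_comm _ j i, cutInd_mul_self, hij, and_self, if_true, false_and,
      if_false] at h2 ⊢
    linarith
  simp only [h₁, h₂, if_false, add_zero, mul_one]
  by_cases hi : a ≠ i ∧ b ≠ i
  · linarith [two_mul_sum_cutInd_mul_of_notMem hij hi.1 hi.2]
  · have hj : a ≠ j ∧ b ≠ j := by grind
    simp only [cutInd_comm _ i j]
    linarith [two_mul_sum_cutInd_mul_of_notMem hij.symm hj.1 hj.2]

lemma two_mul_cutTrace {n : ℕ} {g : Fin n → Fin n → ℝ} (hs : ∀ i j, g i j = g j i)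
    (C : Finset (Fin n)) :
    2 * cutTrace g C = ∑ i, ∑ j, g i j * cutInd C i j := by
  have h₁ : cutTrace g C = ∑ i, ∑ j, if i ∈ C ∧ j ∉ C then g i j else 0 := by
    simp only [ite_and, sum_ite_irrel, sum_const_zero, ← mem_compl, sum_ite_mem, univ_inter,
      cutTrace]
  have h₂ : cutTrace g C = ∑ i, ∑ j, if j ∈ C ∧ i ∉ C then g i j else 0 := by
    rw [h₁, sum_comm]
    simp only [hs]
  rw [two_mul]
  nth_rewrite 1 [h₁]
  rw [h₂, ← sum_add_distrib]
  refine sum_congr rfl fun i _ => ?_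
  rw [← sum_add_distrib]
  refine sum_congr rfl fun j _ => ?_
  by_cases hi : i ∈ C <;> by_cases hj : j ∈ C <;> simp [cutInd, hi, hj]

lemma two_mul_traceMetric {n : ℕ} {g : Fin n → Fin n → ℝ} (h0 : ∀ i, g i i = 0)
    (hs : ∀ i j, g i j = g j i) : 2 * traceMetric g = ∑ i, ∑ j, g i j := by
  have h₁ : traceMetric g = ∑ i, ∑ j, if i < j then g i j else 0 := by
    simp only [traceMetric, sum_filter]
  have h₂ : traceMetric g = ∑ i, ∑ j, if j < i then g i j else 0 := by
    rw [h₁, sum_comm]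
    simp only [hs]
  rw [two_mul]
  nth_rewrite 1 [h₁]
  rw [h₂, ← sum_add_distrib]
  refine sum_congr rfl fun i _ => ?_
  rw [← sum_add_distrib]
  refine sum_congr rfl fun j _ => ?_
  rcases lt_trichotomy i j with h | rfl | h
  · simp [h, h.not_gt]
  · simp [h0]
  · simp [h, h.not_gt]

lemma sum_cutInd_mul_cutTrace {n : ℕ} {g : Fin n → Fin n → ℝ} (h0 : ∀ i, g i i = 0)
    (hs : ∀ i j, g i j = g j i) {a b : Fin n} (hab : a ≠ b) :
    4 * ∑ C : Finset (Fin n), cutInd C a b * cutTrace g C =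
      2 ^ n * (traceMetric g + g a b) := by
  have key : 8 * ∑ C : Finset (Fin n), cutInd C a b * cutTrace g C =
      ∑ i, ∑ j, g i j * (4 * ∑ C : Finset (Fin n), cutInd C a b * cutInd C i j) := by
    calc _ = 4 * ∑ C : Finset (Fin n), cutInd C a b * (2 * cutTrace g C) := by
          simp only [mul_sum]
          exact sum_congr rfl fun C _ => by ring
      _ = ∑ C : Finset (Fin n), ∑ i, ∑ j, g i j * (4 * (cutInd C a b * cutInd C i j)) := by
          simp only [two_mul_cutTrace hs, mul_sum]
          exact sum_congr rfl fun C _ => sum_congr rfl fun i _ => sum_congr rfl fun j _ => by ring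
      _ = _ := by
          simp only [mul_sum]
          rw [sum_comm]
          exact sum_congr rfl fun i _ => sum_comm
  have hterm : ∀ i j, g i j * (4 * ∑ C : Finset (Fin n), cutInd C a b * cutInd C i j) =
      2 ^ n * (g i j + (if i = a then if j = b then g i j else 0 else 0) +
        (if i = b then if j = a then g i j else 0 else 0)) := by
    intro i j
    by_cases hij : i = j
    · subst hij
      simp [h0]
    · rw [four_mul_sum_cutInd_mul hab hij]
      simp only [← ite_and]
      split_ifs <;> ring
  simp only [hterm, ← mul_sum, sum_add_distrib, ← two_mul_traceMetric h0 hs] at key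
  simp [sum_ite_irrel, hs b a] at key
  linarith

lemma cutTrace_discrete {n : ℕ} (C : Finset (Fin n)) :
    cutTrace (fun i j => if i = j then 0 else 1) C = (C.card : ℝ) * ((n : ℝ) - C.card) := by
  have h : cutTrace (fun i j => if i = j then 0 else 1) C = ∑ i ∈ C, ∑ j ∈ Cᶜ, (1 : ℝ) := by
    refine sum_congr rfl fun i hi => sum_congr rfl fun j hj => if_neg ?_
    rintro rfl
    exact mem_compl.1 hj hi
  have hc : C.card ≤ n := by simpa using card_le_univ C
  rw [h]
  simp [card_compl, Nat.cast_sub hc, mul_sub]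

lemma traceMetric_discrete (n : ℕ) :
    traceMetric (fun i j : Fin n => if i = j then 0 else 1) = (n.choose 2 : ℝ) := by
  have h := two_mul_traceMetric (g := fun i j : Fin n => if i = j then 0 else 1)
    (by simp) (by simp [eq_comm])
  have h' : ∀ i : Fin n, ∑ j, (if i = j then 0 else 1 : ℝ) = n - 1 := by
    intro i
    have : ∀ j, (if i = j then 0 else 1 : ℝ) = 1 - if i = j then 1 else 0 := by
      intro j
      split_ifs <;> simp
    simp [this]
  simp only [h'] at h
  simp at h
  rw [Nat.cast_choose_two]
  linarith

lemma card_pair_inter_eq_one {n : ℕ} {a b : Fin n} (h : a ≠ b) (C : Finset (Fin n)) :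
    (if (({a, b} : Finset (Fin n)) ∩ C).card = 1 then 1 else 0 : ℝ) = cutInd C a b := by
  by_cases ha : a ∈ C <;> by_cases hb : b ∈ C <;>
    simp [cutInd, insert_inter_of_mem, insert_inter_of_notMem, ha, hb, h]

/-- For `n ≥ 3`, `m = C(n,2)` and a metric `d` on `V_n` (regarded
as the vector in `ℝ^m` with `{i,j}`-coordinate `d(i,j)`), the vector `w` with
coordinates `w_C = (1/2^{n−2})·(s_C − (|C|·(n−|C|)/(m+1))·Tr(d))` satisfies `S·w = d`. -/
theorem fullCutMatrix_particular_solution (n : ℕ) (hn : 3 ≤ n)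
    (d : Fin n → Fin n → ℝ) (hd : IsMetric d) :
    (fullCutMatrix n).mulVec
        (fun C : Cuts n => (2 ^ (n - 2) : ℝ)⁻¹ *
          (cutTrace d C.1 -
            ((C.1.card : ℝ) * ((n : ℝ) - (C.1.card : ℝ)) / ((n.choose 2 : ℝ) + 1)) *
              traceMetric d)) =
      fun P => pairEval d P.1 := by
  obtain ⟨h0, hs, -, -⟩ := hd
  funext P
  obtain ⟨P, hP⟩ := P
  obtain ⟨a, b, hab, rfl⟩ := card_eq_two.1 hP
  have hR : pairEval d {a, b} = d a b := by
    simp [pairEval, sum_pair hab, h0, hs b a]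
  have hm : (n.choose 2 : ℝ) + 1 ≠ 0 := by positivity
  have hpow : (2 : ℝ) ^ n = 4 * 2 ^ (n - 2) := by
    rw [show (4 : ℝ) = 2 ^ 2 by norm_num, ← pow_add]
    congr 1
    omega
  have hd := sum_cutInd_mul_cutTrace h0 hs hab
  have h1 := sum_cutInd_mul_cutTrace (g := fun i j : Fin n => if i = j then 0 else 1)
    (by simp) (by simp [eq_comm]) hab
  simp only [cutTrace_discrete, traceMetric_discrete, hab, if_false] at h1
  simp only [mulVec, dotProduct, fullCutMatrix, of_apply, card_pair_inter_eq_one hab, hR]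
  set w : Finset (Fin n) → ℝ := fun C => cutInd C a b * ((2 ^ (n - 2) : ℝ)⁻¹ *
    (cutTrace d C - ((C.card : ℝ) * ((n : ℝ) - (C.card : ℝ)) / ((n.choose 2 : ℝ) + 1)) *
      traceMetric d)) with hw
  have hcuts : ∑ C : Cuts n, w C.1 = ∑ C, w C := by
    rw [← sum_subtype (univ.filter fun C : Finset (Fin n) => C ≠ ∅ ∧ C ≠ univ) (by simp) w]
    refine sum_subset (subset_univ _) fun C _ hC => ?_
    have hC : C = ∅ ∨ C = univ := by
      simp only [mem_filter, mem_univ, true_and] at hC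
      tauto
    rcases hC with rfl | rfl <;> simp [hw, cutInd]
  have hsplit : ∑ C, w C = (2 ^ (n - 2) : ℝ)⁻¹ * (∑ C, cutInd C a b * cutTrace d C -
      (∑ C : Finset (Fin n), cutInd C a b * ((C.card : ℝ) * ((n : ℝ) - C.card))) *
        (traceMetric d / ((n.choose 2 : ℝ) + 1))) := by
    rw [sum_mul, ← sum_sub_distrib, mul_sum]
    exact sum_congr rfl fun C _ => by simp only [hw]; ring
  rw [hpow] at hd h1
  have hd' : ∑ C, cutInd C a b * cutTrace d C = 2 ^ (n - 2) * (traceMetric d + d a b) := by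
    linarith
  have h1' : ∑ C : Finset (Fin n), cutInd C a b * ((C.card : ℝ) * ((n : ℝ) - C.card)) =
      2 ^ (n - 2) * ((n.choose 2 : ℝ) + 1) := by
    linarith
  refine hcuts.trans ?_
  rw [hsplit, hd', h1']
  field_simp
  ring
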